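/- Let a chain datum on [a,b] satisfy the moment map relations. Let j ∈ ℤ and ℓ₁, ℓ₂ ≥ 0, set q = j + ℓ₁ − ℓ₂, and assume a ≤ j, a ≤ q−1, and j+ℓ₁+1 ≤ b. If the ε-condition holds at the single vertex q (i.e. V_q = range x_{q+1} + range y_q), then, as subspaces of V_j, range(Xcomp(ℓ₁, j+ℓ₁) ∘ Ycomp(ℓ₂, q)) = range(Xcomp(ℓ₁+1, j+ℓ₁+1) ∘ Ycomp(ℓ₂, q+1)) + range(Xcomp(ℓ₁, j+ℓ₁) ∘ Ycomp(ℓ₂+1, q−1)). -/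

import Mathlib

/-!
A *chain datum* on an integer interval `[a,b]`: finite-dimensional complex vector
spaces `V j` and linear maps `x j : V j → V (j-1)`, `y j : V (j-1) → V j`.
(The data is given for all `j : ℤ`; all hypotheses and conclusions only refer to
indices in the interval `[a,b]`.)
-/

variable (V : ℤ → Type) [∀ j, AddCommGroup (V j)] [∀ j, Module ℂ (V j)]
  [∀ j, FiniteDimensional ℂ (V j)]

/-- Transport along an equality of indices. -/
def castV {i j : ℤ} (h : i = j) : V i →ₗ[ℂ] V j := by subst h; exact LinearMap.id

variable (x : ∀ j : ℤ, V j →ₗ[ℂ] V (j - 1)) (y : ∀ j : ℤ, V (j - 1) →ₗ[ℂ] V j)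

/-- `Xcomp ℓ i = x_{i-ℓ+1} ∘ ⋯ ∘ x_i : V i → V (i - ℓ)`. -/
def Xcomp : (ℓ : ℕ) → (i : ℤ) → (V i →ₗ[ℂ] V (i - (ℓ : ℤ)))
  | 0, i => castV V (by simp)
  | (ℓ + 1), i =>
      (castV V (show i - 1 - (ℓ : ℤ) = i - ((ℓ : ℕ) + 1 : ℕ) by push_cast; ring)).comp
        ((Xcomp ℓ (i - 1)).comp (x i))

/-- `Ycomp ℓ i = y_{i+ℓ} ∘ ⋯ ∘ y_{i+1} : V i → V (i + ℓ)`. -/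
def Ycomp : (ℓ : ℕ) → (i : ℤ) → (V i →ₗ[ℂ] V (i + (ℓ : ℤ)))
  | 0, i => castV V (by simp)
  | (ℓ + 1), i =>
      (castV V (show i + 1 + (ℓ : ℤ) = i + ((ℓ : ℕ) + 1 : ℕ) by push_cast; ring)).comp
        ((Ycomp ℓ (i + 1)).comp ((y (i + 1)).comp (castV V (show i = i + 1 - 1 by ring))))

/-- The moment map relations `y_j ∘ x_j = x_{j+1} ∘ y_{j+1}` for `a < j < b`. -/
def MomentMap (a b : ℤ) : Prop :=
  ∀ j : ℤ, a < j → j < b →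
    (y j).comp (x j) =
      (castV V (show j + 1 - 1 = j by ring)).comp
        ((x (j + 1)).comp ((y (j + 1)).comp (castV V (show j = j + 1 - 1 by ring))))

/-- The stability condition: `ker x_p ∩ ker y_{p+1} = 0` for `a < p < b`. -/
def Stability (a b : ℤ) : Prop :=
  ∀ p : ℤ, a < p → p < b →
    LinearMap.ker (x p) ⊓
      LinearMap.ker ((y (p + 1)).comp (castV V (show p = p + 1 - 1 by ring))) = ⊥

/-- The ε-condition: `V_p = range x_{p+1} + range y_p` for `a < p < b`. -/
def EpsCond (a b : ℤ) : Prop :=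
  ∀ p : ℤ, a < p → p < b →
    LinearMap.range ((castV V (show p + 1 - 1 = p by ring)).comp (x (p + 1))) ⊔
      LinearMap.range (y p) = ⊤

/-- `s`-boundedness: each `y_j ∘ x_j` is nilpotent and `dim V_j ≤ s` on `[a,b]`. -/
def SBounded (s : ℕ) (a b : ℤ) : Prop :=
  (∀ j : ℤ, a < j → j ≤ b → IsNilpotent ((y j).comp (x j) : Module.End ℂ (V j))) ∧
  (∀ j : ℤ, a ≤ j → j ≤ b → Module.finrank ℂ (V j) ≤ s)

@[simp]
theorem castV_self {V : ℤ → Type} [∀ j, AddCommGroup (V j)] [∀ j, Module ℂ (V j)]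
    {i : ℤ} (h : i = i) (v : V i) : castV V h v = v := rfl

@[simp]
theorem castV_castV {V : ℤ → Type} [∀ j, AddCommGroup (V j)] [∀ j, Module ℂ (V j)]
    {i j k : ℤ} (h : i = j) (h' : j = k) (v : V i) :
    castV V h' (castV V h v) = castV V (h.trans h') v := by
  subst h h'; rfl

/-- A family of maps `V i → V (s i)` commutes with transport along equalities of indices. -/
theorem map_castV {V : ℤ → Type} [∀ j, AddCommGroup (V j)] [∀ j, Module ℂ (V j)] {s t : ℤ → ℤ}
    (f : ∀ i, V (s i) →ₗ[ℂ] V (t i)) {i j : ℤ} (h : i = j) (h' : s i = s j) (v : V (s i)) :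
    f j (castV V h' v) = castV V (congrArg t h) (f i v) := by
  subst h; rfl

/-- Under the moment map relations, `x` can be moved past a composite of `y`s. -/
theorem Ycomp_castV_x {V : ℤ → Type} [∀ j, AddCommGroup (V j)] [∀ j, Module ℂ (V j)]
    {x : ∀ j : ℤ, V j →ₗ[ℂ] V (j - 1)} {y : ∀ j : ℤ, V (j - 1) →ₗ[ℂ] V j} {a b : ℤ}
    (hmm : MomentMap V x y a b) (ℓ : ℕ) (q : ℤ) (ha : a ≤ q) (hb : q + ℓ < b) (v : V (q + 1)) :
    Ycomp V y ℓ q (castV V (by ring) (x (q + 1) v)) =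
      castV V (by ring) (x (q + 1 + ℓ) (Ycomp V y ℓ (q + 1) v)) := by
  induction ℓ generalizing q with
  | zero =>
    simp only [Ycomp, castV_castV]
    rw [map_castV x (show q + 1 = q + 1 + ((0 : ℕ) : ℤ) by simp), castV_castV]
  | succ ℓ ih =>
    push_cast at hb
    have hm := LinearMap.congr_fun (hmm (q + 1) (by omega) (by omega)) v
    simp only [LinearMap.comp_apply] at hm
    simp only [Ycomp, LinearMap.comp_apply, castV_castV, castV_self]
    rw [hm, ih (q + 1) (by omega) (by omega),
      map_castV x (show q + 1 + 1 + (ℓ : ℤ) = q + 1 + ((ℓ + 1 : ℕ) : ℤ) by push_cast; ring)]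
    simp only [castV_castV]

/-- Under the moment map relations, with `q = j + ℓ₁ − ℓ₂`,
`a ≤ j`, `a ≤ q−1`, `j+ℓ₁+1 ≤ b`, if the ε-condition holds at the single vertex
`q`, then, as subspaces of `V j`,
`range (Xcomp(ℓ₁, j+ℓ₁) ∘ Ycomp(ℓ₂, q))
  = range (Xcomp(ℓ₁+1, j+ℓ₁+1) ∘ Ycomp(ℓ₂, q+1)) + range (Xcomp(ℓ₁, j+ℓ₁) ∘ Ycomp(ℓ₂+1, q−1))`. -/
theorem statement5 (a b : ℤ) (hab : a < b) (hmm : MomentMap V x y a b)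
    (j q : ℤ) (ℓ₁ ℓ₂ : ℕ) (hq : q = j + ℓ₁ - ℓ₂)
    (h₁ : a ≤ j) (h₂ : a ≤ q - 1) (h₃ : j + ℓ₁ + 1 ≤ b)
    (hepsq : LinearMap.range ((castV V (show q + 1 - 1 = q by ring)).comp (x (q + 1))) ⊔
      LinearMap.range (y q) = ⊤) :
    LinearMap.range ((castV V (show j + (ℓ₁ : ℤ) - (ℓ₁ : ℤ) = j by ring)).comp
        ((Xcomp V x ℓ₁ (j + ℓ₁)).comp
          ((castV V (show q + (ℓ₂ : ℤ) = j + (ℓ₁ : ℤ) by omega)).comp (Ycomp V y ℓ₂ q))))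
      =
    LinearMap.range ((castV V (show j + (ℓ₁ : ℤ) + 1 - ((ℓ₁ : ℕ) + 1 : ℕ) = j by push_cast; ring)).comp
        ((Xcomp V x (ℓ₁ + 1) (j + ℓ₁ + 1)).comp
          ((castV V (show q + 1 + (ℓ₂ : ℤ) = j + (ℓ₁ : ℤ) + 1 by omega)).comp
            (Ycomp V y ℓ₂ (q + 1)))))
      ⊔
    LinearMap.range ((castV V (show j + (ℓ₁ : ℤ) - (ℓ₁ : ℤ) = j by ring)).comp
        ((Xcomp V x ℓ₁ (j + ℓ₁)).comp
          ((castV V (show q - 1 + ((ℓ₂ : ℕ) + 1 : ℕ) = j + (ℓ₁ : ℤ) by omega)).comp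
            (Ycomp V y (ℓ₂ + 1) (q - 1))))) := by
  have hX (v : V (q + 1)) :
      castV V (show j + (ℓ₁ : ℤ) - (ℓ₁ : ℤ) = j by ring) (Xcomp V x ℓ₁ (j + ℓ₁)
        (castV V (show q + (ℓ₂ : ℤ) = j + (ℓ₁ : ℤ) by omega)
          (Ycomp V y ℓ₂ q (castV V (show q + 1 - 1 = q by ring) (x (q + 1) v))))) =
      castV V (show j + (ℓ₁ : ℤ) + 1 - ((ℓ₁ : ℕ) + 1 : ℕ) = j by push_cast; ring)
        (Xcomp V x (ℓ₁ + 1) (j + ℓ₁ + 1)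
          (castV V (show q + 1 + (ℓ₂ : ℤ) = j + (ℓ₁ : ℤ) + 1 by omega)
            (Ycomp V y ℓ₂ (q + 1) v))) := by
    rw [Ycomp_castV_x hmm ℓ₂ q (by omega) (by omega), castV_castV]
    simp only [Xcomp, LinearMap.comp_apply, castV_castV]
    rw [map_castV x (show q + 1 + (ℓ₂ : ℤ) = j + ℓ₁ + 1 by omega),
      map_castV (Xcomp V x ℓ₁) (show q + 1 + (ℓ₂ : ℤ) - 1 = j + ℓ₁ by omega),
      map_castV (Xcomp V x ℓ₁) (show q + 1 + (ℓ₂ : ℤ) - 1 = j + ℓ₁ + 1 - 1 by omega)]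
    simp only [castV_castV]
  have hY (v : V (q - 1)) :
      castV V (show q + (ℓ₂ : ℤ) = j + (ℓ₁ : ℤ) by omega) (Ycomp V y ℓ₂ q (y q v)) =
      castV V (show q - 1 + ((ℓ₂ : ℕ) + 1 : ℕ) = j + (ℓ₁ : ℤ) by omega)
        (Ycomp V y (ℓ₂ + 1) (q - 1) v) := by
    simp only [Ycomp, LinearMap.comp_apply, castV_castV]
    rw [map_castV y (show q = q - 1 + 1 by ring),
      map_castV (Ycomp V y ℓ₂) (show q = q - 1 + 1 by ring), castV_castV]
  rw [LinearMap.range_eq_map, ← hepsq, Submodule.map_sup, ← LinearMap.range_comp,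
    ← LinearMap.range_comp]
  congr 2
  · ext v
    exact hX v
  · ext v
    simp only [LinearMap.comp_apply, hY]
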